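/- arXiv:1809.00013 — 6 statements merged into one kernel-verified Lean document; each statement's English description precedes it below -/
import Mathlib

section
/- Let A, B ∈ ℝ^{d×n} be real matrices and suppose A Bᵀ = U Σ Vᵀ where U, V ∈ ℝ^{d×d} are orthogonal (UᵀU = I, VᵀV = I) and Σ is diagonal with nonnegative diagonal entries. Then P* = U Vᵀ solves the orthogonal Procrustes problem: for every orthogonal Q ∈ ℝ^{d×d}, ‖A − P* B‖_F ≤ ‖A − Q B‖_F. -/
open Matrix BigOperators

noncomputable section

/-- Frobenius norm of a real matrix. -/
def frobNorm {d n : ℕ} (M : Matrix (Fin d) (Fin n) ℝ) : ℝ :=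
  Real.sqrt (∑ i, ∑ j, (M i j) ^ 2)

theorem sum_sq_eq_trace {d n : ℕ} (M : Matrix (Fin d) (Fin n) ℝ) :
    ∑ i, ∑ j, (M i j) ^ 2 = (M * Mᵀ).trace := by
  simp [Matrix.trace, Matrix.mul_apply, pow_two]

/-- Expansion of the squared Frobenius norm of `A - Q * B` for orthogonal `Q`. -/
theorem sum_sq_sub_mul_orthogonal {d n : ℕ} (A B : Matrix (Fin d) (Fin n) ℝ)
    {Q : Matrix (Fin d) (Fin d) ℝ} (hQ : Qᵀ * Q = 1) :
    ∑ i, ∑ j, ((A - Q * B) i j) ^ 2 =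
      (A * Aᵀ).trace + (B * Bᵀ).trace - 2 * (Qᵀ * (A * Bᵀ)).trace := by
  have hcross : (A * (Bᵀ * Qᵀ)).trace = (Qᵀ * (A * Bᵀ)).trace := by
    rw [← Matrix.mul_assoc, Matrix.trace_mul_comm]
  have hcross' : (Q * B * Aᵀ).trace = (Qᵀ * (A * Bᵀ)).trace := by
    rw [← hcross, ← Matrix.trace_transpose]
    simp [Matrix.transpose_mul]
  have hsq : (Q * B * (Bᵀ * Qᵀ)).trace = (B * Bᵀ).trace := by
    rw [← Matrix.mul_assoc, Matrix.trace_mul_comm, Matrix.mul_assoc Q, ← Matrix.mul_assoc Qᵀ, hQ,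
      Matrix.one_mul]
  rw [sum_sq_eq_trace]
  simp only [Matrix.transpose_sub, Matrix.transpose_mul, Matrix.sub_mul, Matrix.mul_sub,
    Matrix.trace_sub, hcross, hcross', hsq]
  ring

theorem diag_le_one_of_orthogonal {d : ℕ} {Z : Matrix (Fin d) (Fin d) ℝ} (hZ : Zᵀ * Z = 1)
    (i : Fin d) : Z i i ≤ 1 := by
  have hcol : ∑ k, Z k i * Z k i = 1 := by
    simpa [Matrix.mul_apply] using congrFun (congrFun hZ i) i
  have hle : Z i i * Z i i ≤ ∑ k, Z k i * Z k i :=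
    Finset.single_le_sum (f := fun k => Z k i * Z k i)
      (fun k _ => mul_self_nonneg (Z k i)) (Finset.mem_univ i)
  nlinarith

theorem trace_orthogonal_mul_diag_le {d : ℕ} {Z S : Matrix (Fin d) (Fin d) ℝ} (hZ : Zᵀ * Z = 1)
    (hSdiag : S.IsDiag) (hSnn : ∀ i, 0 ≤ S i i) : (Z * S).trace ≤ S.trace := by
  rw [← hSdiag.diagonal_diag]
  simp only [Matrix.trace, Matrix.diag_apply, Matrix.mul_diagonal, Matrix.diagonal_apply_eq]
  exact Finset.sum_le_sum fun i _ =>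
    mul_le_of_le_one_left (hSnn i) (diag_le_one_of_orthogonal hZ i)

/-- If A Bᵀ = U Σ Vᵀ with U, V orthogonal and Σ diagonal with nonnegative entries,
then P* = U Vᵀ solves the orthogonal Procrustes problem. -/
theorem procrustes_solution {d n : ℕ}
    (A B : Matrix (Fin d) (Fin n) ℝ)
    (U V S : Matrix (Fin d) (Fin d) ℝ)
    (hU : Uᵀ * U = 1) (hV : Vᵀ * V = 1)
    (hSdiag : S.IsDiag) (hSnn : ∀ i, 0 ≤ S i i)
    (hSVD : A * Bᵀ = U * S * Vᵀ) :
    ∀ Q : Matrix (Fin d) (Fin d) ℝ, Qᵀ * Q = 1 →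
      frobNorm (A - (U * Vᵀ) * B) ≤ frobNorm (A - Q * B) := by
  intro Q hQ
  have hU' : U * Uᵀ = 1 := mul_eq_one_comm.mp hU
  have hV' : V * Vᵀ = 1 := mul_eq_one_comm.mp hV
  have hQ' : Q * Qᵀ = 1 := mul_eq_one_comm.mp hQ
  have hP : (U * Vᵀ)ᵀ * (U * Vᵀ) = 1 := by
    rw [Matrix.transpose_mul, Matrix.transpose_transpose, Matrix.mul_assoc,
      ← Matrix.mul_assoc Uᵀ, hU, Matrix.one_mul, hV']
  have hZ : (Vᵀ * Qᵀ * U)ᵀ * (Vᵀ * Qᵀ * U) = 1 := by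
    calc (Vᵀ * Qᵀ * U)ᵀ * (Vᵀ * Qᵀ * U) = Uᵀ * (Q * (V * Vᵀ) * Qᵀ) * U := by
          simp [Matrix.transpose_mul, Matrix.mul_assoc]
      _ = 1 := by rw [hV', Matrix.mul_one, hQ', Matrix.mul_one, hU]
  have hPtrace : ((U * Vᵀ)ᵀ * (A * Bᵀ)).trace = S.trace := by
    calc ((U * Vᵀ)ᵀ * (A * Bᵀ)).trace = (V * ((Uᵀ * U) * S * Vᵀ)).trace := by
          simp [hSVD, Matrix.transpose_mul, Matrix.mul_assoc]
      _ = S.trace := by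
          rw [hU, Matrix.one_mul, Matrix.trace_mul_comm, Matrix.mul_assoc, hV, Matrix.mul_one]
  have hQtrace : (Qᵀ * (A * Bᵀ)).trace = (Vᵀ * Qᵀ * U * S).trace := by
    rw [hSVD, ← Matrix.mul_assoc, Matrix.trace_mul_comm]
    simp only [Matrix.mul_assoc]
  refine Real.sqrt_le_sqrt ?_
  rw [sum_sq_sub_mul_orthogonal A B hP, sum_sq_sub_mul_orthogonal A B hQ, hPtrace, hQtrace]
  linarith [trace_orthogonal_mul_diag_le hZ hSdiag hSnn]
end
end

section
/- Let M ∈ ℝ^{d×d} and suppose M = U Σ Vᵀ where U, V ∈ ℝ^{d×d} are orthogonal and Σ is diagonal with nonnegative diagonal entries. Then for every orthogonal Q ∈ ℝ^{d×d}, trace(Qᵀ M) ≤ trace(Σ), and equality holds for Q = U Vᵀ. -/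
open Matrix BigOperators

noncomputable section

/-- Right multiplication by a nonnegative diagonal matrix `S` of a real matrix with
orthonormal columns does not give a larger trace than `S`. -/
theorem trace_mul_le_trace_of_isDiag {n : Type*} [Fintype n] [DecidableEq n]
    {W S : Matrix n n ℝ} (hW : Wᵀ * W = 1) (hS : S.IsDiag) (hnn : ∀ i, 0 ≤ S i i) :
    Matrix.trace (W * S) ≤ Matrix.trace S := by
  have hW' : W ∈ Matrix.unitaryGroup n ℝ := by
    rwa [Matrix.mem_unitaryGroup_iff', Matrix.star_eq_conjTranspose,
      Matrix.conjTranspose_eq_transpose_of_trivial]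
  rw [← hS.diagonal_diag]
  simp only [Matrix.trace, Matrix.diag_apply, Matrix.mul_diagonal, Matrix.diagonal_apply_eq]
  exact Finset.sum_le_sum fun i _ =>
    mul_le_of_le_one_left (hnn i)
      ((Real.le_norm_self _).trans (entry_norm_bound_of_unitary hW' i i))

/-- If M = U Σ Vᵀ with U, V orthogonal and Σ diagonal with nonnegative diagonal
entries, then trace(Qᵀ M) ≤ trace(Σ) for every orthogonal Q, with equality
attained at Q = U Vᵀ. -/
theorem trace_bound_of_svd {d : ℕ}
    (M U V S : Matrix (Fin d) (Fin d) ℝ)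
    (hU : Uᵀ * U = 1) (hV : Vᵀ * V = 1)
    (hSdiag : S.IsDiag) (hSnn : ∀ i, 0 ≤ S i i)
    (hSVD : M = U * S * Vᵀ) :
    (∀ Q : Matrix (Fin d) (Fin d) ℝ, Qᵀ * Q = 1 →
      Matrix.trace (Qᵀ * M) ≤ Matrix.trace S) ∧
    Matrix.trace ((U * Vᵀ)ᵀ * M) = Matrix.trace S := by
  subst hSVD
  refine ⟨fun Q hQ => ?_, ?_⟩
  · have hQ' : Q * Qᵀ = 1 := mul_eq_one_comm.mp hQ
    have hW : (Vᵀ * Qᵀ * U)ᵀ * (Vᵀ * Qᵀ * U) = 1 := by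
      have hV' : V * Vᵀ = 1 := mul_eq_one_comm.mp hV
      calc (Vᵀ * Qᵀ * U)ᵀ * (Vᵀ * Qᵀ * U)
          = Uᵀ * (Q * (V * Vᵀ) * Qᵀ) * U := by
            simp only [Matrix.transpose_mul, Matrix.transpose_transpose, Matrix.mul_assoc]
        _ = 1 := by rw [hV', Matrix.mul_one, hQ', Matrix.mul_one, hU]
    calc Matrix.trace (Qᵀ * (U * S * Vᵀ))
        = Matrix.trace (Vᵀ * Qᵀ * U * S) := by
          rw [← Matrix.mul_assoc, Matrix.trace_mul_comm]
          simp only [Matrix.mul_assoc]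
      _ ≤ Matrix.trace S := trace_mul_le_trace_of_isDiag hW hSdiag hSnn
  · calc Matrix.trace ((U * Vᵀ)ᵀ * (U * S * Vᵀ))
        = Matrix.trace (V * ((Uᵀ * U) * S * Vᵀ)) := by
          simp only [Matrix.transpose_mul, Matrix.transpose_transpose, Matrix.mul_assoc]
      _ = Matrix.trace S := by
          rw [hU, Matrix.one_mul, Matrix.trace_mul_comm, Matrix.mul_assoc, hV, Matrix.mul_one]
end
end

section
/- Let p ∈ ℝ^n and q ∈ ℝ^m be probability vectors with strictly positive entries, let C ∈ ℝ^{n×m}, and let λ > 0. If Γ* minimizes the entropy-regularized transport objective ⟨Γ, C⟩ − λ H(Γ) over the transport polytope Π(p,q), then Γ* has the diagonal-scaling form: there exist strictly positive vectors a ∈ ℝ^n and b ∈ ℝ^m such that Γ*_{ij} = a_i · exp(−C_{ij}/λ) · b_j for all i, j. In particular all entries of Γ* are strictly positive. -/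
open Matrix BigOperators

noncomputable section

/-- `p` is a probability vector. -/
def IsProbVec {n : ℕ} (p : Fin n → ℝ) : Prop :=
  (∀ i, 0 ≤ p i) ∧ ∑ i, p i = 1

/-- Membership in the transport polytope Π(p,q). -/
def InPolytope {n m : ℕ} (p : Fin n → ℝ) (q : Fin m → ℝ)
    (Γ : Matrix (Fin n) (Fin m) ℝ) : Prop :=
  (∀ i j, 0 ≤ Γ i j) ∧ (∀ i, ∑ j, Γ i j = p i) ∧ (∀ j, ∑ i, Γ i j = q j)

/-- Entropy H(Γ) = −∑_{i,j} Γ_{ij}(log Γ_{ij} − 1), with 0·log 0 = 0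
(automatic since `Real.log 0 = 0`). -/
def entropy {n m : ℕ} (Γ : Matrix (Fin n) (Fin m) ℝ) : ℝ :=
  -∑ i, ∑ j, Γ i j * (Real.log (Γ i j) - 1)

/-- The entropy-regularized transport objective ⟨Γ, C⟩ − λ H(Γ). -/
def entObj {n m : ℕ} (C : Matrix (Fin n) (Fin m) ℝ) (lam : ℝ)
    (Γ : Matrix (Fin n) (Fin m) ℝ) : ℝ :=
  (∑ i, ∑ j, Γ i j * C i j) - lam * entropy Γ

/-- The contribution of one matrix entry `x` of cost `c` to the objective. -/
def entryObj (lam c x : ℝ) : ℝ := x * c + lam * (x * (Real.log x - 1))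

lemma entObj_eq_sum {n m : ℕ} (C : Matrix (Fin n) (Fin m) ℝ) (lam : ℝ)
    (Γ : Matrix (Fin n) (Fin m) ℝ) :
    entObj C lam Γ = ∑ i, ∑ j, entryObj lam (C i j) (Γ i j) := by
  simp only [entObj, entropy, entryObj, Finset.sum_add_distrib, Finset.mul_sum, mul_neg,
    sub_neg_eq_add]

lemma entryObj_convex {lam c x y t : ℝ} (hlam : 0 ≤ lam) (hx : 0 ≤ x) (hy : 0 ≤ y)
    (ht0 : 0 ≤ t) (ht1 : t ≤ 1) :
    entryObj lam c ((1 - t) * x + t * y) ≤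
      (1 - t) * entryObj lam c x + t * entryObj lam c y := by
  have h := Real.convexOn_mul_log.2 (Set.mem_Ici.2 hx) (Set.mem_Ici.2 hy)
    (sub_nonneg.2 ht1) ht0 (by ring)
  simp only [smul_eq_mul] at h
  have h' := mul_le_mul_of_nonneg_left h hlam
  simp only [entryObj]
  linarith

lemma entryObj_mul {lam c y t : ℝ} (hy : y ≠ 0) (ht : t ≠ 0) :
    entryObj lam c (t * y) = t * entryObj lam c y + lam * (t * y * Real.log t) := by
  simp only [entryObj, Real.log_mul ht hy]
  ring

lemma hasDerivAt_entryObj {lam c x : ℝ} (hx : x ≠ 0) :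
    HasDerivAt (entryObj lam c) (c + lam * Real.log x) x := by
  have h := ((hasDerivAt_id x).mul_const c).add
    (((hasDerivAt_id x).mul ((Real.hasDerivAt_log hx).sub_const 1)).const_mul lam)
  refine h.congr_deriv ?_
  simp only [id]
  field_simp
  ring

lemma InPolytope.convexComb {n m : ℕ} {p : Fin n → ℝ} {q : Fin m → ℝ}
    {Γ P : Matrix (Fin n) (Fin m) ℝ} (hΓ : InPolytope p q Γ) (hP : InPolytope p q P)
    {t : ℝ} (ht0 : 0 ≤ t) (ht1 : t ≤ 1) :
    InPolytope p q ((1 - t) • Γ + t • P) := by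
  simp only [InPolytope, Matrix.add_apply, Matrix.smul_apply, smul_eq_mul]
  refine ⟨fun i j => ?_, fun i => ?_, fun j => ?_⟩
  · have := hΓ.1 i j
    have := hP.1 i j
    have := sub_nonneg.2 ht1
    positivity
  · rw [Finset.sum_add_distrib, ← Finset.mul_sum, ← Finset.mul_sum, hΓ.2.1, hP.2.1]
    ring
  · rw [Finset.sum_add_distrib, ← Finset.mul_sum, ← Finset.mul_sum, hΓ.2.2, hP.2.2]
    ring

lemma inPolytope_product {n m : ℕ} {p : Fin n → ℝ} {q : Fin m → ℝ}
    (hp : IsProbVec p) (hq : IsProbVec q) : InPolytope p q (fun i j => p i * q j) := by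
  refine ⟨fun i j => mul_nonneg (hp.1 i) (hq.1 j), fun i => ?_, fun j => ?_⟩
  · rw [← Finset.mul_sum, hq.2, mul_one]
  · rw [← Finset.sum_mul, hp.2, one_mul]

/-- Moving from a plan with a zero entry towards an entrywise positive plan changes the
objective by at most an affine function of `t` plus a term of order `t * log t`. -/
lemma entObj_convexComb_le {n m : ℕ} (C : Matrix (Fin n) (Fin m) ℝ) {lam : ℝ} (hlam : 0 ≤ lam)
    {Γ P : Matrix (Fin n) (Fin m) ℝ} (hΓ : ∀ i j, 0 ≤ Γ i j) (hP : ∀ i j, 0 < P i j)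
    {i₀ : Fin n} {j₀ : Fin m} (h₀ : Γ i₀ j₀ = 0) {t : ℝ} (ht0 : 0 < t) (ht1 : t ≤ 1) :
    entObj C lam ((1 - t) • Γ + t • P) ≤
      (1 - t) * entObj C lam Γ + t * entObj C lam P + lam * (t * P i₀ j₀ * Real.log t) := by
  have key : ∀ i j, entryObj lam (C i j) ((1 - t) * Γ i j + t * P i j) ≤
      (1 - t) * entryObj lam (C i j) (Γ i j) + t * entryObj lam (C i j) (P i j) +
        (if i = i₀ then if j = j₀ then lam * (t * P i₀ j₀ * Real.log t) else 0 else 0) := by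
    intro i j
    split_ifs with hi hj
    · subst hi hj
      rw [h₀, mul_zero, zero_add, entryObj_mul (hP i j).ne' ht0.ne']
      simp [entryObj]
    all_goals
      rw [add_zero]
      exact entryObj_convex hlam (hΓ i j) (hP i j).le ht0.le ht1
  simp only [entObj_eq_sum, Matrix.add_apply, Matrix.smul_apply, smul_eq_mul]
  refine (Finset.sum_le_sum fun i _ => Finset.sum_le_sum fun j _ => key i j).trans_eq ?_
  simp [Finset.sum_add_distrib, Finset.mul_sum, Finset.sum_ite_irrel]

lemma pos_of_isMinimizer {n m : ℕ} {p : Fin n → ℝ} {q : Fin m → ℝ}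
    (hp : IsProbVec p) (hq : IsProbVec q) (hppos : ∀ i, 0 < p i) (hqpos : ∀ j, 0 < q j)
    {C : Matrix (Fin n) (Fin m) ℝ} {lam : ℝ} (hlam : 0 < lam)
    {Γ : Matrix (Fin n) (Fin m) ℝ} (hΓ : InPolytope p q Γ)
    (hmin : ∀ Γ', InPolytope p q Γ' → entObj C lam Γ ≤ entObj C lam Γ')
    (i : Fin n) (j : Fin m) : 0 < Γ i j := by
  refine (hΓ.1 i j).lt_of_ne fun h₀ => ?_
  have hP := inPolytope_product hp hq
  have hy : 0 < lam * (p i * q j) := mul_pos hlam (mul_pos (hppos i) (hqpos j))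
  set P : Matrix (Fin n) (Fin m) ℝ := fun i j => p i * q j
  set d := entObj C lam P - entObj C lam Γ with hd
  have hd0 : 0 ≤ d := sub_nonneg.2 (hmin P hP)
  set K := (d + 1) / (lam * (p i * q j))
  have hK0 : 0 ≤ K := by positivity
  have ht1 : Real.exp (-K) ≤ 1 := Real.exp_le_one_iff.2 (neg_nonpos.2 hK0)
  have hle := (hmin _ (hΓ.convexComb hP (Real.exp_pos _).le ht1)).trans
    (entObj_convexComb_le C hlam.le hΓ.1 (fun i j => mul_pos (hppos i) (hqpos j))
      h₀.symm (Real.exp_pos (-K)) ht1)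
  rw [Real.log_exp] at hle
  have hKy : K * (lam * (p i * q j)) = d + 1 := div_mul_cancel₀ _ hy.ne'
  have : 0 ≤ Real.exp (-K) * (d - K * (lam * (p i * q j))) := by
    simp only [P] at hle hd ⊢
    rw [hd]
    linarith
  rw [hKy] at this
  have := Real.exp_pos (-K)
  linarith

/-- First-order optimality along a direction with vanishing row and column sums. -/
lemma sum_mul_gradient_eq_zero {n m : ℕ} {p : Fin n → ℝ} {q : Fin m → ℝ}
    {C : Matrix (Fin n) (Fin m) ℝ} {lam : ℝ}
    {Γ : Matrix (Fin n) (Fin m) ℝ} (hΓ : InPolytope p q Γ)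
    (hmin : ∀ Γ', InPolytope p q Γ' → entObj C lam Γ ≤ entObj C lam Γ')
    (hpos : ∀ i j, 0 < Γ i j) {D : Matrix (Fin n) (Fin m) ℝ}
    (hrow : ∀ i, ∑ j, D i j = 0) (hcol : ∀ j, ∑ i, D i j = 0) :
    ∑ i, ∑ j, (C i j + lam * Real.log (Γ i j)) * D i j = 0 := by
  have hlin : ∀ i j, HasDerivAt (fun t : ℝ => Γ i j + t * D i j) (D i j) 0 := fun i j => by
    simpa using ((hasDerivAt_id (0 : ℝ)).mul_const (D i j)).const_add (Γ i j)
  have hderiv : HasDerivAt (fun t : ℝ => entObj C lam (Γ + t • D))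
      (∑ i, ∑ j, (C i j + lam * Real.log (Γ i j)) * D i j) 0 := by
    simp only [entObj_eq_sum, Matrix.add_apply, Matrix.smul_apply, smul_eq_mul]
    refine HasDerivAt.fun_sum fun i _ => HasDerivAt.fun_sum fun j _ => ?_
    exact HasDerivAt.comp_of_eq (0 : ℝ) (hasDerivAt_entryObj (hpos i j).ne') (hlin i j)
      (by simp)
  have hfeas : ∀ᶠ t : ℝ in nhds 0, ∀ i j, 0 < Γ i j + t * D i j := by
    refine Filter.eventually_all.2 fun i => Filter.eventually_all.2 fun j => ?_
    exact (hlin i j).continuousAt.eventually_const_lt (by simpa using hpos i j)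
  refine IsLocalMin.hasDerivAt_eq_zero ?_ hderiv
  filter_upwards [hfeas] with t ht
  rw [zero_smul, add_zero]
  refine hmin _ ?_
  simp only [InPolytope, Matrix.add_apply, Matrix.smul_apply, smul_eq_mul]
  refine ⟨fun i j => (ht i j).le, fun i => ?_, fun j => ?_⟩
  · rw [Finset.sum_add_distrib, ← Finset.mul_sum, hΓ.2.1, hrow, mul_zero, add_zero]
  · rw [Finset.sum_add_distrib, ← Finset.mul_sum, hΓ.2.2, hcol, mul_zero, add_zero]

/-- A matrix orthogonal to every matrix with vanishing row and column sums satisfies the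
four-point identity of matrices of the form `u i + v j`. -/
lemma four_point_of_orthogonal {n m : ℕ} {g : Matrix (Fin n) (Fin m) ℝ}
    (hg : ∀ D : Matrix (Fin n) (Fin m) ℝ, (∀ i, ∑ j, D i j = 0) → (∀ j, ∑ i, D i j = 0) →
      ∑ i, ∑ j, g i j * D i j = 0) (i k : Fin n) (j l : Fin m) :
    g i j = g i l + g k j - g k l := by
  let u : Fin n → ℝ := Pi.single i 1 - Pi.single k 1
  let v : Fin m → ℝ := Pi.single j 1 - Pi.single l 1
  have hu : ∑ a, u a = 0 := by simp [u, Finset.sum_sub_distrib]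
  have hv : ∑ b, v b = 0 := by simp [v, Finset.sum_sub_distrib]
  have h := hg (fun a b => u a * v b)
    (fun a => by rw [← Finset.mul_sum, hv, mul_zero])
    (fun b => by rw [← Finset.sum_mul, hu, zero_mul])
  have hsum : ∀ a, ∑ b, g a b * (u a * v b) = (g a j - g a l) * u a := fun a => by
    simp only [v, Pi.sub_apply, mul_sub, Finset.sum_sub_distrib, Pi.single_apply, mul_ite,
      mul_one, mul_zero, Finset.sum_ite_eq', Finset.mem_univ, if_true]
    ring
  simp only [hsum] at h
  simp only [u, Pi.sub_apply, mul_sub, Finset.sum_sub_distrib, Pi.single_apply, mul_ite,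
    mul_one, mul_zero, Finset.sum_ite_eq', Finset.mem_univ, if_true] at h
  linarith

/-- A minimizer of the entropy-regularized transport objective over Π(p,q)
has the diagonal scaling form Γ*_{ij} = a_i exp(−C_{ij}/λ) b_j with a, b > 0;
in particular all its entries are strictly positive. -/
theorem sinkhorn_scaling_form {n m : ℕ}
    (p : Fin n → ℝ) (q : Fin m → ℝ)
    (hp : IsProbVec p) (hq : IsProbVec q)
    (hppos : ∀ i, 0 < p i) (hqpos : ∀ j, 0 < q j)
    (C : Matrix (Fin n) (Fin m) ℝ) (lam : ℝ) (hlam : 0 < lam)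
    (Γstar : Matrix (Fin n) (Fin m) ℝ)
    (hΓ : InPolytope p q Γstar)
    (hmin : ∀ Γ, InPolytope p q Γ → entObj C lam Γstar ≤ entObj C lam Γ) :
    (∃ a : Fin n → ℝ, ∃ b : Fin m → ℝ,
      (∀ i, 0 < a i) ∧ (∀ j, 0 < b j) ∧
      ∀ i j, Γstar i j = a i * Real.exp (-C i j / lam) * b j) ∧
    (∀ i j, 0 < Γstar i j) := by
  have hpos := pos_of_isMinimizer hp hq hppos hqpos hlam hΓ hmin
  refine ⟨?_, hpos⟩
  obtain ⟨i₀⟩ : Nonempty (Fin n) := by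
    by_contra h
    rw [not_nonempty_iff] at h
    simpa using hp.2
  obtain ⟨j₀⟩ : Nonempty (Fin m) := by
    by_contra h
    rw [not_nonempty_iff] at h
    simpa using hq.2
  let g : Matrix (Fin n) (Fin m) ℝ := fun i j => C i j + lam * Real.log (Γstar i j)
  have hg : ∀ i j, g i j = g i j₀ + g i₀ j - g i₀ j₀ := fun i j =>
    four_point_of_orthogonal
      (fun D hrow hcol => sum_mul_gradient_eq_zero hΓ hmin hpos hrow hcol) i i₀ j j₀
  refine ⟨fun i => Real.exp (g i j₀ / lam), fun j => Real.exp ((g i₀ j - g i₀ j₀) / lam),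
    fun i => Real.exp_pos _, fun j => Real.exp_pos _, fun i j => ?_⟩
  rw [← Real.exp_add, ← Real.exp_add, ← Real.exp_log (hpos i j)]
  congr 1
  have h := hg i j
  rw [show g i j = C i j + lam * Real.log (Γstar i j) from rfl] at h
  field_simp
  linarith
end
end

section
/- Let p ∈ ℝ^n and q ∈ ℝ^m be probability vectors, C ∈ ℝ^{n×n}, C' ∈ ℝ^{m×m}, and Γ ∈ Π(p,q). Then for all indices i and j, ∑_{k,l} (C_{ik} − C'_{jl})² Γ_{kl} = ∑_k C_{ik}² p_k + ∑_l (C'_{jl})² q_l − 2·(C Γ (C')ᵀ)_{ij}. In other words, the fourth-order tensor contraction defining the gradient of the squared-loss Gromov–Wasserstein objective reduces to the pseudo-cost matrix Ĉ_Γ = C_xy − 2 C Γ (C')ᵀ, where (C_xy)_{ij} = ∑_k C_{ik}² p_k + ∑_l (C'_{jl})² q_l. -/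
open Matrix BigOperators

noncomputable section

/-- For Γ ∈ Π(p,q), the fourth-order tensor contraction defining the gradient of
the squared-loss Gromov–Wasserstein objective reduces to the pseudo-cost matrix:
∑_{k,l} (C_{ik} − C'_{jl})² Γ_{kl} = ∑_k C_{ik}² p_k + ∑_l (C'_{jl})² q_l
− 2 (C Γ (C')ᵀ)_{ij}. -/
theorem gw_pseudocost_reduction {n m : ℕ}
    (p : Fin n → ℝ) (q : Fin m → ℝ)
    (hp : IsProbVec p) (hq : IsProbVec q)
    (C : Matrix (Fin n) (Fin n) ℝ) (C' : Matrix (Fin m) (Fin m) ℝ)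
    (Γ : Matrix (Fin n) (Fin m) ℝ) (hΓ : InPolytope p q Γ) :
    ∀ i j, ∑ k, ∑ l, (C i k - C' j l) ^ 2 * Γ k l =
      (∑ k, (C i k) ^ 2 * p k) + (∑ l, (C' j l) ^ 2 * q l)
        - 2 * (C * Γ * C'ᵀ) i j := by
  intro i j
  obtain ⟨-, hrow, hcol⟩ := hΓ
  have hp_sum : ∑ k, (C i k) ^ 2 * p k = ∑ k, ∑ l, (C i k) ^ 2 * Γ k l := by
    simp_rw [← hrow, Finset.mul_sum]
  have hq_sum : ∑ l, (C' j l) ^ 2 * q l = ∑ k, ∑ l, (C' j l) ^ 2 * Γ k l := by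
    simp_rw [← hcol, Finset.mul_sum]
    exact Finset.sum_comm
  have hcross : (C * Γ * C'ᵀ) i j = ∑ k, ∑ l, C i k * Γ k l * C' j l := by
    simp_rw [Matrix.mul_apply, Matrix.transpose_apply, Finset.sum_mul]
    exact Finset.sum_comm
  rw [hp_sum, hq_sum, hcross]
  simp_rw [Finset.mul_sum, ← Finset.sum_add_distrib, ← Finset.sum_sub_distrib]
  refine Finset.sum_congr rfl fun k _ => Finset.sum_congr rfl fun l _ => ?_
  ring
end
end

section
/- Let p ∈ ℝ^n and q ∈ ℝ^m be probability vectors, C ∈ ℝ^{n×n}, C' ∈ ℝ^{m×m}, and Γ ∈ Π(p,q). Then the squared-loss Gromov–Wasserstein objective decomposes as E(Γ) = ∑_{i,j,k,l} (C_{ik} − C'_{jl})² Γ_{ij} Γ_{kl} = ∑_{i,j} Γ_{ij} (∑_k C_{ik}² p_k + ∑_l (C'_{jl})² q_l) − 2 ∑_{i,j} Γ_{ij} (C Γ (C')ᵀ)_{ij}, so that E(Γ) = ⟨C_xy − 2 C Γ (C')ᵀ, Γ⟩ with (C_xy)_{ij} = ∑_k C_{ik}² p_k + ∑_l (C'_{jl})²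 q_l. This reduces the naive O(n²m²) fourth-order tensor evaluation to matrix products. -/
open Matrix BigOperators

noncomputable section

/-- The squared-loss Gromov–Wasserstein objective. -/
def GWobj {n m : ℕ} (C : Matrix (Fin n) (Fin n) ℝ) (C' : Matrix (Fin m) (Fin m) ℝ)
    (Γ : Matrix (Fin n) (Fin m) ℝ) : ℝ :=
  ∑ i, ∑ j, ∑ k, ∑ l, (C i k - C' j l) ^ 2 * Γ i j * Γ k l

/-- Contracting the squared-loss tensor with `Γ` in its last two indices. -/
theorem sum_sq_sub_mul_eq {n m : ℕ} {p : Fin n → ℝ} {q : Fin m → ℝ}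
    (C : Matrix (Fin n) (Fin n) ℝ) (C' : Matrix (Fin m) (Fin m) ℝ)
    {Γ : Matrix (Fin n) (Fin m) ℝ} (hΓ : InPolytope p q Γ) (i : Fin n) (j : Fin m) :
    ∑ k, ∑ l, (C i k - C' j l) ^ 2 * Γ k l =
      ((∑ k, (C i k) ^ 2 * p k) + ∑ l, (C' j l) ^ 2 * q l) - 2 * (C * Γ * C'ᵀ) i j := by
  have hrow : ∑ k, (C i k) ^ 2 * p k = ∑ k, ∑ l, (C i k) ^ 2 * Γ k l := by
    simp_rw [← hΓ.2.1, Finset.mul_sum]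
  have hcol : ∑ l, (C' j l) ^ 2 * q l = ∑ k, ∑ l, (C' j l) ^ 2 * Γ k l := by
    simp_rw [← hΓ.2.2, Finset.mul_sum]
    exact Finset.sum_comm
  have hcross : (C * Γ * C'ᵀ) i j = ∑ k, ∑ l, C i k * Γ k l * C' j l := by
    simp_rw [Matrix.mul_apply, Matrix.transpose_apply, Finset.sum_mul]
    exact Finset.sum_comm
  simp_rw [hrow, hcol, hcross, Finset.mul_sum, ← Finset.sum_add_distrib,
    ← Finset.sum_sub_distrib]
  exact Finset.sum_congr rfl fun k _ => Finset.sum_congr rfl fun l _ => by ring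

/-- For Γ ∈ Π(p,q), the squared-loss Gromov–Wasserstein objective decomposes as
E(Γ) = ∑_{i,j} Γ_{ij}(∑_k C_{ik}² p_k + ∑_l (C'_{jl})² q_l)
− 2 ∑_{i,j} Γ_{ij} (C Γ (C')ᵀ)_{ij}, i.e. E(Γ) = ⟨C_xy − 2 C Γ (C')ᵀ, Γ⟩. -/
theorem gw_objective_decomposition {n m : ℕ}
    (p : Fin n → ℝ) (q : Fin m → ℝ)
    (hp : IsProbVec p) (hq : IsProbVec q)
    (C : Matrix (Fin n) (Fin n) ℝ) (C' : Matrix (Fin m) (Fin m) ℝ)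
    (Γ : Matrix (Fin n) (Fin m) ℝ) (hΓ : InPolytope p q Γ) :
    GWobj C C' Γ =
        (∑ i, ∑ j, Γ i j * ((∑ k, (C i k) ^ 2 * p k) + ∑ l, (C' j l) ^ 2 * q l))
          - 2 * ∑ i, ∑ j, Γ i j * (C * Γ * C'ᵀ) i j ∧
    GWobj C C' Γ =
        ∑ i, ∑ j, (((∑ k, (C i k) ^ 2 * p k) + ∑ l, (C' j l) ^ 2 * q l)
          - 2 * (C * Γ * C'ᵀ) i j) * Γ i j := by
  have h : GWobj C C' Γ =
      ∑ i, ∑ j, (((∑ k, (C i k) ^ 2 * p k) + ∑ l, (C' j l) ^ 2 * q l)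
        - 2 * (C * Γ * C'ᵀ) i j) * Γ i j := by
    simp_rw [GWobj, ← sum_sq_sub_mul_eq C C' hΓ, Finset.sum_mul, mul_right_comm]
  refine ⟨?_, h⟩
  simp_rw [h, Finset.mul_sum _ _ (2 : ℝ), ← Finset.sum_sub_distrib]
  exact Finset.sum_congr rfl fun i _ => Finset.sum_congr rfl fun j _ => by ring
end
end

section
/- (Triangle inequality for the Gromov–Wasserstein distance, discrete case; part of the theorem of Mémoli that GW^{1/2} with the squared loss is a distance on metric measure spaces.) Let p ∈ ℝ^n, q ∈ ℝ^m, r ∈ ℝ^s be probability vectors with q having strictly positive entries, and let C₁ ∈ ℝ^{n×n}, C₂ ∈ ℝ^{m×m}, C₃ ∈ ℝ^{s×s}. Then sqrt(GW(C₁, C₃, p, r)) ≤ sqrt(GW(C₁, C₂, p, q)) + sqrt(GW(C₂, C₃, q, r)). -/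
open Matrix BigOperators

noncomputable section

/-- The squared-loss Gromov–Wasserstein value GW(C, C', p, q). -/
def GW {n m : ℕ} (C : Matrix (Fin n) (Fin n) ℝ) (C' : Matrix (Fin m) (Fin m) ℝ)
    (p : Fin n → ℝ) (q : Fin m → ℝ) : ℝ :=
  sInf {v : ℝ | ∃ Γ : Matrix (Fin n) (Fin m) ℝ, InPolytope p q Γ ∧ v = GWobj C C' Γ}

/-- Minkowski's inequality for a weighted quadratic mean over a finite type. -/
theorem sqrt_sum_weighted_sq_add_le {α : Type*} [Fintype α] (w f g : α → ℝ)
    (hw : ∀ a, 0 ≤ w a) :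
    Real.sqrt (∑ a, (f a + g a) ^ 2 * w a) ≤
      Real.sqrt (∑ a, f a ^ 2 * w a) + Real.sqrt (∑ a, g a ^ 2 * w a) := by
  have h := norm_add_le (WithLp.toLp 2 fun a => f a * Real.sqrt (w a) : EuclideanSpace ℝ α)
    (WithLp.toLp 2 fun a => g a * Real.sqrt (w a))
  simpa [EuclideanSpace.norm_eq, ← add_mul, mul_pow, Real.sq_sqrt (hw _)] using h

/-- If `Γ` is the image of the weight `w` under `(φ, ψ)`, the objective at `Γ` is a sum
over pairs of points weighted by `w`. -/
theorem GWobj_eq_sum_of_pushforward {α : Type*} [Fintype α] {n m : ℕ} (w : α → ℝ)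
    (φ : α → Fin n) (ψ : α → Fin m) (Γ : Matrix (Fin n) (Fin m) ℝ)
    (h : ∀ F : Fin n → Fin m → ℝ, ∑ a, F (φ a) (ψ a) * w a = ∑ i, ∑ j, F i j * Γ i j)
    (C : Matrix (Fin n) (Fin n) ℝ) (C' : Matrix (Fin m) (Fin m) ℝ) :
    GWobj C C' Γ =
      ∑ x : α × α, (C (φ x.1) (φ x.2) - C' (ψ x.1) (ψ x.2)) ^ 2 * (w x.1 * w x.2) := by
  have h₂ : ∀ i j, ∑ k, ∑ l, (C i k - C' j l) ^ 2 * Γ i j * Γ k l =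
      (∑ b, (C i (φ b) - C' j (ψ b)) ^ 2 * w b) * Γ i j := by
    intro i j
    rw [h fun k l => (C i k - C' j l) ^ 2, Finset.sum_mul]
    refine Finset.sum_congr rfl fun k _ => ?_
    rw [Finset.sum_mul]
    exact Finset.sum_congr rfl fun l _ => by ring
  rw [GWobj, Fintype.sum_prod_type]
  simp only [h₂]
  rw [← h fun i j => ∑ b, (C i (φ b) - C' j (ψ b)) ^ 2 * w b]
  refine Finset.sum_congr rfl fun a _ => ?_
  rw [Finset.sum_mul]
  exact Finset.sum_congr rfl fun b _ => by ring

/-- Any two probability vectors admit a coupling. -/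
theorem exists_inPolytope {n m : ℕ} {p : Fin n → ℝ} {q : Fin m → ℝ}
    (hp : IsProbVec p) (hq : IsProbVec q) : ∃ Γ, InPolytope p q Γ := by
  refine ⟨fun i j => p i * q j, fun i j => mul_nonneg (hp.1 i) (hq.1 j), fun i => ?_, fun j => ?_⟩
  · rw [← Finset.mul_sum, hq.2, mul_one]
  · rw [← Finset.sum_mul, hp.2, one_mul]

theorem GWobj_nonneg {n m : ℕ} {p : Fin n → ℝ} {q : Fin m → ℝ}
    {Γ : Matrix (Fin n) (Fin m) ℝ} (hΓ : InPolytope p q Γ)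
    (C : Matrix (Fin n) (Fin n) ℝ) (C' : Matrix (Fin m) (Fin m) ℝ) : 0 ≤ GWobj C C' Γ :=
  Finset.sum_nonneg fun i _ => Finset.sum_nonneg fun j _ => Finset.sum_nonneg fun k _ =>
    Finset.sum_nonneg fun l _ => mul_nonneg (mul_nonneg (sq_nonneg _) (hΓ.1 i j)) (hΓ.1 k l)

theorem GW_le_GWobj {n m : ℕ} {p : Fin n → ℝ} {q : Fin m → ℝ}
    {Γ : Matrix (Fin n) (Fin m) ℝ} (hΓ : InPolytope p q Γ)
    (C : Matrix (Fin n) (Fin n) ℝ) (C' : Matrix (Fin m) (Fin m) ℝ) :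
    GW C C' p q ≤ GWobj C C' Γ := by
  refine csInf_le ⟨0, ?_⟩ ⟨Γ, hΓ, rfl⟩
  rintro _ ⟨Γ', hΓ', rfl⟩
  exact GWobj_nonneg hΓ' C C'

theorem le_sqrt_GW {n m : ℕ} {p : Fin n → ℝ} {q : Fin m → ℝ}
    (hp : IsProbVec p) (hq : IsProbVec q)
    {C : Matrix (Fin n) (Fin n) ℝ} {C' : Matrix (Fin m) (Fin m) ℝ} {c : ℝ}
    (h : ∀ Γ, InPolytope p q Γ → c ≤ Real.sqrt (GWobj C C' Γ)) :
    c ≤ Real.sqrt (GW C C' p q) := by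
  rcases le_or_gt c 0 with hc | hc
  · exact hc.trans (Real.sqrt_nonneg _)
  rw [Real.le_sqrt' hc]
  obtain ⟨Γ₀, hΓ₀⟩ := exists_inPolytope hp hq
  refine le_csInf ⟨_, Γ₀, hΓ₀, rfl⟩ ?_
  rintro _ ⟨Γ, hΓ, rfl⟩
  exact (Real.le_sqrt' hc).1 (h Γ hΓ)

/-- Couplings glued along a positive middle marginal satisfy the triangle inequality. -/
theorem exists_gluing {n m s : ℕ} {p : Fin n → ℝ} {q : Fin m → ℝ} {r : Fin s → ℝ}
    (hqpos : ∀ j, 0 < q j)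
    (C₁ : Matrix (Fin n) (Fin n) ℝ) (C₂ : Matrix (Fin m) (Fin m) ℝ)
    (C₃ : Matrix (Fin s) (Fin s) ℝ)
    {Γ : Matrix (Fin n) (Fin m) ℝ} {Δ : Matrix (Fin m) (Fin s) ℝ}
    (hΓ : InPolytope p q Γ) (hΔ : InPolytope q r Δ) :
    ∃ T, InPolytope p r T ∧ Real.sqrt (GWobj C₁ C₃ T) ≤
      Real.sqrt (GWobj C₁ C₂ Γ) + Real.sqrt (GWobj C₂ C₃ Δ) := by
  set g : Fin n → Fin m → Fin s → ℝ := fun i j k => Γ i j * Δ j k / q j with hg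
  have hg_nonneg : ∀ i j k, 0 ≤ g i j k := fun i j k =>
    div_nonneg (mul_nonneg (hΓ.1 i j) (hΔ.1 j k)) (hqpos j).le
  have hg₃ : ∀ i j, ∑ k, g i j k = Γ i j := by
    intro i j
    simp only [hg]
    rw [← Finset.sum_div, ← Finset.mul_sum, hΔ.2.1, mul_div_cancel_right₀ _ (hqpos j).ne']
  have hg₁ : ∀ j k, ∑ i, g i j k = Δ j k := by
    intro j k
    simp only [hg]
    rw [← Finset.sum_div, ← Finset.sum_mul, hΓ.2.2, mul_div_cancel_left₀ _ (hqpos j).ne']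
  let w : Fin n × Fin m × Fin s → ℝ := fun a => g a.1 a.2.1 a.2.2
  have e₁₂ := GWobj_eq_sum_of_pushforward w (fun a => a.1) (fun a => a.2.1) Γ
    (fun F => by
      simp only [w, Fintype.sum_prod_type, ← Finset.mul_sum, hg₃]) C₁ C₂
  have e₂₃ := GWobj_eq_sum_of_pushforward w (fun a => a.2.1) (fun a => a.2.2) Δ
    (fun F => by
      simp only [w, Fintype.sum_prod_type]
      rw [Finset.sum_comm]
      refine Finset.sum_congr rfl fun j _ => ?_
      rw [Finset.sum_comm]
      simp only [← Finset.mul_sum, hg₁]) C₂ C₃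
  have e₁₃ := GWobj_eq_sum_of_pushforward w (fun a => a.1) (fun a => a.2.2)
    (fun i k => ∑ j, g i j k)
    (fun F => by
      simp only [w, Fintype.sum_prod_type]
      refine Finset.sum_congr rfl fun i _ => ?_
      rw [Finset.sum_comm]
      simp only [← Finset.mul_sum]) C₁ C₃
  refine ⟨fun i k => ∑ j, g i j k, ⟨fun i k => Finset.sum_nonneg fun j _ => hg_nonneg i j k,
    fun i => ?_, fun k => ?_⟩, ?_⟩
  · rw [Finset.sum_comm]
    simp only [hg₃, hΓ.2.1]
  · rw [Finset.sum_comm]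
    simp only [hg₁, hΔ.2.2]
  · rw [e₁₂, e₂₃, e₁₃]
    simpa only [sub_add_sub_cancel] using sqrt_sum_weighted_sq_add_le
      (fun x : (Fin n × Fin m × Fin s) × (Fin n × Fin m × Fin s) => w x.1 * w x.2)
      (fun x => C₁ x.1.1 x.2.1 - C₂ x.1.2.1 x.2.2.1)
      (fun x => C₂ x.1.2.1 x.2.2.1 - C₃ x.1.2.2 x.2.2.2)
      (fun x => mul_nonneg (hg_nonneg _ _ _) (hg_nonneg _ _ _))

/-- Triangle inequality for the Gromov–Wasserstein distance (discrete case):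
sqrt(GW(C₁,C₃,p,r)) ≤ sqrt(GW(C₁,C₂,p,q)) + sqrt(GW(C₂,C₃,q,r)). -/
theorem gw_triangle_inequality {n m s : ℕ}
    (p : Fin n → ℝ) (q : Fin m → ℝ) (r : Fin s → ℝ)
    (hp : IsProbVec p) (hq : IsProbVec q) (hr : IsProbVec r)
    (hqpos : ∀ j, 0 < q j)
    (C₁ : Matrix (Fin n) (Fin n) ℝ) (C₂ : Matrix (Fin m) (Fin m) ℝ)
    (C₃ : Matrix (Fin s) (Fin s) ℝ) :
    Real.sqrt (GW C₁ C₃ p r) ≤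
      Real.sqrt (GW C₁ C₂ p q) + Real.sqrt (GW C₂ C₃ q r) := by
  rw [← sub_le_iff_le_add]
  refine le_sqrt_GW hp hq fun Γ hΓ => ?_
  rw [sub_le_comm]
  refine le_sqrt_GW hq hr fun Δ hΔ => ?_
  rw [sub_le_iff_le_add']
  obtain ⟨T, hT, hle⟩ := exists_gluing hqpos C₁ C₂ C₃ hΓ hΔ
  exact (Real.sqrt_le_sqrt (GW_le_GWobj hT C₁ C₃)).trans hle
end
end
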